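/- Let A, B, C be groups and κ_A : C → A, κ_B : C → B injective homomorphisms. If κ_A(C) is left relatively convex in A and κ_B(C) is left relatively convex in B, then the images of A and of B in the amalgamated free product A ★_C B are left relatively convex subgroups of A ★_C B. -/

import Mathlib

open Monoid

variable {A B C : Type*} [Group A] [Group B] [Group C]

/-- The relations of the amalgamated free product `A ★_C B`. -/
def amalRels (κA : C →* A) (κB : C →* B) : Subgroup (Coprod A B) :=
  Subgroup.normalClosure {x | ∃ c : C, x = (Coprod.inl (κA c))⁻¹ * Coprod.inr (κB c)}

instance (κA : C →* A) (κB : C →* B) : (amalRels κA κB).Normal :=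
  Subgroup.normalClosure_normal

/-- The amalgamated free product `A ★_C B`: the quotient of the free product
`A ∗ B` by the normal closure of `{κ_A(c)⁻¹ κ_B(c) | c ∈ C}`. -/
def Amal (κA : C →* A) (κB : C →* B) : Type _ :=
  Coprod A B ⧸ amalRels κA κB

instance (κA : C →* A) (κB : C →* B) : Group (Amal κA κB) :=
  QuotientGroup.Quotient.group _

/-- The canonical homomorphism `A →* A ★_C B`. -/
def amalInl (κA : C →* A) (κB : C →* B) : A →* Amal κA κB :=
  (QuotientGroup.mk' (amalRels κA κB)).comp Coprod.inl

/-- The canonical homomorphism `B →* A ★_C B`. -/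
def amalInr (κA : C →* A) (κB : C →* B) : B →* Amal κA κB :=
  (QuotientGroup.mk' (amalRels κA κB)).comp Coprod.inr

/-- A subgroup `H ≤ G` is left relatively convex if the coset space `G/H`
carries a linear order invariant under the left translation action of `G`. -/
def LeftRelConvex {G : Type*} [Group G] (H : Subgroup G) : Prop :=
  ∃ r : G ⧸ H → G ⧸ H → Prop, IsLinearOrder (G ⧸ H) r ∧
    ∀ (g : G) (x y : G ⧸ H), r x y → r (g • x) (g • y)

/-- Sign functions on a group relative to the image of `κ`. -/
structure IsSgn {A C : Type*} [Group A] [Group C] (κ : C →* A) (s : A → ℤ) : Prop where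
  vals : ∀ a, s a = 0 ∨ s a = 1 ∨ s a = -1
  zero : ∀ a, s a = 0 ↔ ∃ c, κ c = a
  inv : ∀ a, s a⁻¹ = - s a
  pos : ∀ a b, s a = 1 → s b = 1 → s (a * b) = 1
  left : ∀ c a, s (κ c * a) = s a
  right : ∀ a c, s (a * κ c) = s a

theorem IsSgn.defect {A C : Type*} [Group A] [Group C] {κ : C →* A} {s : A → ℤ}
    (h : IsSgn κ s) (x y : A) : |s (x * y) - s x - s y| ≤ 1 := by
  rw [abs_le]
  have h1 := h.vals x
  have h2 := h.vals y
  have h3 := h.vals (x * y)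
  have h4 := h.pos x y
  have h5 := h.pos y⁻¹ x⁻¹
  rw [← mul_inv_rev, h.inv, h.inv, h.inv] at h5
  have h6 : s x = 0 → s (x * y) = s y := by
    intro hx
    obtain ⟨c, rfl⟩ := (h.zero x).1 hx
    exact h.left c y
  have h7 : s y = 0 → s (x * y) = s x := by
    intro hx
    obtain ⟨c, rfl⟩ := (h.zero y).1 hx
    exact h.right x c
  omega

theorem exists_isSgn {A C : Type*} [Group A] [Group C] (κ : C →* A)
    (h : LeftRelConvex κ.range) : ∃ s : A → ℤ, IsSgn κ s := by
  classical
  obtain ⟨r, hr, hinv⟩ := h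
  have hrefl : ∀ x, r x x := hr.refl
  have htrans : ∀ x y z, r x y → r y z → r x z := hr.trans
  have hanti : ∀ x y, r x y → r y x → x = y := hr.antisymm
  have htot : ∀ x y, r x y ∨ r y x := hr.total
  let q : A → A ⧸ κ.range := fun a => (a : A ⧸ κ.range)
  have hq : ∀ a b, q a = q b ↔ ∃ c, κ c = a⁻¹ * b := fun a b => QuotientGroup.eq
  have hqinv : ∀ g a b, r (q a) (q b) → r (q (g * a)) (q (g * b)) := fun g a b h => hinv g _ _ h
  let s : A → ℤ := fun a => if q 1 = q a then 0 else if r (q 1) (q a) then 1 else -1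
  have hqm : ∀ a c, q (a * κ c) = q a := by
    intro a c
    rw [hq]
    exact ⟨c⁻¹, by simp⟩
  have hs0 : ∀ a, s a = 0 ↔ q 1 = q a := by
    intro a; simp only [s]; split_ifs <;> simp_all
  have hs1 : ∀ a, s a = 1 ↔ q 1 ≠ q a ∧ r (q 1) (q a) := by
    intro a; simp only [s]; split_ifs <;> simp_all
  have hv : ∀ a, s a = 0 ∨ s a = 1 ∨ s a = -1 := by
    intro a; simp only [s]; split_ifs <;> simp
  have hz : ∀ a, s a = 0 ↔ ∃ c, κ c = a := by
    intro a; rw [hs0, hq]; simp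
  have hzi : ∀ a, s a⁻¹ = 0 ↔ s a = 0 := by
    intro a
    rw [hz, hz]
    constructor
    · rintro ⟨c, hc⟩; exact ⟨c⁻¹, by simp [hc]⟩
    · rintro ⟨c, hc⟩; exact ⟨c⁻¹, by simp [hc]⟩
  have hri : ∀ a, r (q 1) (q a⁻¹) ↔ r (q a) (q 1) := by
    intro a
    constructor
    · intro h; simpa using hqinv a _ _ h
    · intro h; simpa using hqinv a⁻¹ _ _ h
  have hinv' : ∀ a, s a⁻¹ = - s a := by
    intro a
    have h1 := hv a
    have h2 := hv a⁻¹
    have h3 := hzi a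
    by_cases h0 : s a = 0
    · rw [h0, h3.2 h0]; rfl
    have h0' : s a⁻¹ ≠ 0 := fun h => h0 (h3.1 h)
    have hne : q 1 ≠ q a := fun h => h0 ((hs0 a).2 h)
    have hne' : q 1 ≠ q a⁻¹ := fun h => h0' ((hs0 _).2 h)
    have h4 : ¬ (s a = 1 ∧ s a⁻¹ = 1) := by
      rintro ⟨ha, hb⟩
      exact hne (hanti _ _ ((hs1 _).1 ha).2 ((hri a).1 ((hs1 _).1 hb).2))
    have h5 : s a = 1 ∨ s a⁻¹ = 1 := by
      rcases htot (q 1) (q a) with h | h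
      · exact Or.inl ((hs1 _).2 ⟨hne, h⟩)
      · exact Or.inr ((hs1 _).2 ⟨hne', (hri a).2 h⟩)
    omega
  have hle : ∀ c a, s (κ c * a) = s a := by
    intro c a
    have e0 : q 1 = q (κ c * a) ↔ q 1 = q a := by
      rw [← hs0, ← hs0, hz, hz]
      constructor
      · rintro ⟨d, hd⟩; exact ⟨c⁻¹ * d, by simp [hd]⟩
      · rintro ⟨d, hd⟩; exact ⟨c * d, by simp [hd]⟩
    have e1 : r (q 1) (q (κ c * a)) ↔ r (q 1) (q a) := by
      have k1 : q (κ c) = q 1 := by simpa using hqm 1 c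
      have k2 : q (κ c)⁻¹ = q 1 := by simpa using hqm 1 c⁻¹
      constructor
      · intro h
        have := hqinv (κ c)⁻¹ _ _ h
        simpa [k2] using this
      · intro h
        have := hqinv (κ c) _ _ h
        simpa [k1] using this
    simp only [s, e0, e1]
  refine ⟨s, hv, hz, hinv', ?_, hle, ?_⟩
  · intro a b ha hb
    rw [hs1] at ha hb ⊢
    have h1 : r (q a) (q (a * b)) := by simpa using hqinv a _ _ hb.2
    refine ⟨fun h => ?_, htrans _ _ _ ha.2 h1⟩
    rw [← h] at h1
    exact ha.1 (hanti _ _ ha.2 h1)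
  · intro a c
    simp only [s, hqm]

/-- `KVal g n`: `g = b₁ a₁ ⋯ bₖ aₖ` is reduced (with `aₖ` arbitrary) and `n` is the sum of the
signs of all letters but `aₖ`. -/
inductive KVal {A B G : Type*} [Group A] [Group B] [Group G]
    (iA : A →* G) (iB : B →* G) (sA : A → ℤ) (sB : B → ℤ) : G → ℤ → Prop
  | last (b : B) (a : A) (hb : sB b ≠ 0) : KVal iA iB sA sB (iB b * iA a) (sB b)
  | step (b : B) (a : A) (g : G) (n : ℤ) (hb : sB b ≠ 0) (ha : sA a ≠ 0)
      (hg : KVal iA iB sA sB g n) :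
      KVal iA iB sA sB (iB b * (iA a * g)) (sB b + sA a + n)

section core

variable {A B C G : Type*} [Group A] [Group B] [Group C] [Group G]
  {κA : C →* A} {κB : C →* B}
  {iA : A →* G} {iB : B →* G} {sA : A → ℤ} {sB : B → ℤ}

theorem KVal.odd (hA : IsSgn κA sA) (hB : IsSgn κB sB) {g : G} {n : ℤ}
    (h : KVal iA iB sA sB g n) : Odd n := by
  induction h with
  | last b a hb =>
    rcases hB.vals b with h | h | h
    · exact absurd h hb
    · rw [h]; decide
    · rw [h]; decide
  | step b a g n hb ha hg ih =>
    have h1 := hB.vals b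
    have h2 := hA.vals a
    rw [Int.odd_iff] at *
    omega

theorem KVal.mul_right {g : G} {n : ℤ}
    (h : KVal iA iB sA sB g n) (a' : A) : KVal iA iB sA sB (g * iA a') n := by
  induction h with
  | last b a hb =>
    rw [mul_assoc, ← map_mul]
    exact KVal.last _ _ hb
  | step b a g n hb ha hg ih =>
    rw [mul_assoc, mul_assoc]
    exact KVal.step _ _ _ _ hb ha ih

theorem KVal.lem1 (hA : IsSgn κA sA) (hB : IsSgn κB sB) {g : G} {n : ℤ}
    (h : KVal iA iB sA sB g n) : ∀ (a : A) (k : G) (m : ℤ), sA a ≠ 0 → KVal iA iB sA sB k m →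
    ∃ a', KVal iA iB sA sB (iA a' * (g⁻¹ * (iA a * k))) (- n + sA a + m) := by
  induction h with
  | last b a0 hb =>
    intro a k m ha hk
    refine ⟨a0, ?_⟩
    have := KVal.step b⁻¹ a k m (by rw [hB.inv]; simpa using hb) ha hk
    rw [hB.inv] at this
    convert this using 1
    simp [mul_assoc]
  | step b a0 g n hb ha0 hg ih =>
    intro a k m ha hk
    have h1 := KVal.step b⁻¹ a k m (by rw [hB.inv]; simpa using hb) ha hk
    obtain ⟨a', h'⟩ := ih a0⁻¹ _ _ (by rw [hA.inv]; simpa using ha0) h1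
    refine ⟨a', ?_⟩
    rw [hB.inv, hA.inv] at h'
    convert h' using 1
    · simp [mul_assoc]
    · ring

theorem KVal.inv (hA : IsSgn κA sA) (hB : IsSgn κB sB) {g : G} {n : ℤ}
    (h : KVal iA iB sA sB g n) : ∃ a', KVal iA iB sA sB (iA a' * g⁻¹) (- n) := by
  cases h with
  | last b a0 hb =>
    refine ⟨a0, ?_⟩
    have := KVal.last (iA := iA) (iB := iB) (sA := sA) (sB := sB) b⁻¹ 1 (by rw [hB.inv]; simpa using hb)
    rw [hB.inv] at this
    convert this using 1
    simp
  | step b a0 g n hb ha0 hg =>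
    have h1 := KVal.last (iA := iA) (iB := iB) (sA := sA) (sB := sB) b⁻¹ 1 (by rw [hB.inv]; simpa using hb)
    obtain ⟨a', h'⟩ := hg.lem1 hA hB a0⁻¹ _ _ (by rw [hA.inv]; simpa using ha0) h1
    refine ⟨a', ?_⟩
    rw [hB.inv, hA.inv] at h'
    convert h' using 1
    · simp [mul_assoc]
    · ring

theorem KVal.main (hA : IsSgn κA sA) (hB : IsSgn κB sB) (hi : ∀ c, iA (κA c) = iB (κB c))
    {g : G} {n : ℤ} (h : KVal iA iB sA sB g n) : ∀ (a : A) (k : G) (m : ℤ),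
    KVal iA iB sA sB k m →
    (n = m ∧ ∃ a', g⁻¹ * (iA a * k) = iA a') ∨
    ∃ a' l, KVal iA iB sA sB (iA a' * (g⁻¹ * (iA a * k))) l ∧ |l + n - m| ≤ 1 := by
  induction h with
  | last b a0 hb =>
    intro a k m hk
    by_cases ha : sA a = 0
    swap
    · right
      obtain ⟨a', h'⟩ := (KVal.last b a0 hb).lem1 hA hB a k m ha hk
      refine ⟨a', _, h', ?_⟩
      have := hA.vals a
      rw [abs_le]; omega
    obtain ⟨c, rfl⟩ := (hA.zero a).1 ha
    rw [hi]
    cases hk with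
    | last b' a1 hb' =>
      have hd := hB.defect b⁻¹ (κB c * b')
      rw [hB.left, hB.inv, abs_le] at hd
      by_cases h0 : sB (b⁻¹ * (κB c * b')) = 0
      · left
        obtain ⟨d, hd'⟩ := (hB.zero _).1 h0
        constructor
        · have : κB c * b' = b * κB d := by rw [hd']; group
          rw [← hB.left c b', this, hB.right]
        · refine ⟨a0⁻¹ * κA d * a1, ?_⟩
          rw [map_mul, map_mul, hi, hd']
          simp [mul_assoc]
      · right
        refine ⟨a0, sB (b⁻¹ * (κB c * b')), ?_, ?_⟩
        · convert KVal.last (iA := iA) (iB := iB) (sA := sA) _ a1 h0 using 1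
          simp [mul_assoc]
        · rw [abs_le]; omega
    | step b' a1 k' m' hb' ha1 hk' =>
      have hd := hB.defect b⁻¹ (κB c * b')
      rw [hB.left, hB.inv, abs_le] at hd
      right
      by_cases h0 : sB (b⁻¹ * (κB c * b')) = 0
      · obtain ⟨d, hd'⟩ := (hB.zero _).1 h0
        have hbb : sB b' = sB b := by
          have : κB c * b' = b * κB d := by rw [hd']; group
          rw [← hB.left c b', this, hB.right]
        refine ⟨(κA d * a1)⁻¹ * a0, m', ?_, ?_⟩
        · convert hk' using 1
          simp only [map_mul, map_inv, hi, hd']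
          group
        · have := hA.vals a1
          rw [abs_le]; omega
      · refine ⟨a0, sB (b⁻¹ * (κB c * b')) + sA a1 + m', ?_, ?_⟩
        · convert KVal.step _ a1 _ _ h0 ha1 hk' using 1
          simp [mul_assoc]
        · rw [abs_le]; omega
  | step b a0 g n hb ha0 hg ih =>
    intro a k m hk
    by_cases ha : sA a = 0
    swap
    · right
      obtain ⟨a', h'⟩ := (KVal.step b a0 g n hb ha0 hg).lem1 hA hB a k m ha hk
      refine ⟨a', _, h', ?_⟩
      have := hA.vals a
      rw [abs_le]; omega
    obtain ⟨c, rfl⟩ := (hA.zero a).1 ha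
    rw [hi]
    have ha0' : sA a0⁻¹ ≠ 0 := by rw [hA.inv]; simpa using ha0
    cases hk with
    | last b' a1 hb' =>
      have hd := hB.defect b⁻¹ (κB c * b')
      rw [hB.left, hB.inv, abs_le] at hd
      right
      by_cases h0 : sB (b⁻¹ * (κB c * b')) = 0
      · obtain ⟨d, hd'⟩ := (hB.zero _).1 h0
        have hbb : sB b' = sB b := by
          have : κB c * b' = b * κB d := by rw [hd']; group
          rw [← hB.left c b', this, hB.right]
        obtain ⟨a', h'⟩ := hg.inv hA hB
        refine ⟨a', -n, ?_, ?_⟩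
        · convert h'.mul_right (a0⁻¹ * κA d * a1) using 1
          simp only [map_mul, map_inv, hi, hd']
          group
        · have := hA.vals a0
          rw [abs_le]; omega
      · obtain ⟨a', h'⟩ := hg.lem1 hA hB a0⁻¹ _ _ ha0' (KVal.last _ a1 h0)
        refine ⟨a', -n + sA a0⁻¹ + sB (b⁻¹ * (κB c * b')), ?_, ?_⟩
        · convert h' using 1
          simp [mul_assoc]
        · rw [hA.inv, abs_le]; omega
    | step b' a1 k' m' hb' ha1 hk' =>
      have hd := hB.defect b⁻¹ (κB c * b')
      rw [hB.left, hB.inv, abs_le] at hd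
      by_cases h0 : sB (b⁻¹ * (κB c * b')) = 0
      · obtain ⟨d, hd'⟩ := (hB.zero _).1 h0
        have hbb : sB b' = sB b := by
          have : κB c * b' = b * κB d := by rw [hd']; group
          rw [← hB.left c b', this, hB.right]
        have key : (iB b * (iA a0 * g))⁻¹ * (iB (κB c) * (iB b' * (iA a1 * k')))
            = g⁻¹ * (iA (a0⁻¹ * (κA d * a1)) * k') := by
          simp only [map_mul, map_inv, hi, hd']
          group
        rw [key]
        have hd2 := hA.defect a0⁻¹ (κA d * a1)
        rw [hA.left, hA.inv, abs_le] at hd2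
        by_cases h2 : sA (a0⁻¹ * (κA d * a1)) = 0
        · have haa : sA a1 = sA a0 := by
            obtain ⟨e, he⟩ := (hA.zero _).1 h2
            have : κA d * a1 = a0 * κA e := by rw [he]; group
            rw [← hA.left d a1, this, hA.right]
          rcases ih (a0⁻¹ * (κA d * a1)) k' m' hk' with ⟨h3, h4⟩ | ⟨a', l, h3, h4⟩
          · left
            exact ⟨by omega, h4⟩
          · right
            refine ⟨a', l, h3, ?_⟩
            rw [abs_le] at *; omega
        · right
          obtain ⟨a', h'⟩ := hg.lem1 hA hB _ _ _ h2 hk'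
          refine ⟨a', _, h', ?_⟩
          rw [abs_le]; omega
      · right
        obtain ⟨a', h'⟩ := hg.lem1 hA hB a0⁻¹ _ _ ha0' (KVal.step _ a1 _ _ h0 ha1 hk')
        refine ⟨a', -n + sA a0⁻¹ + (sB (b⁻¹ * (κB c * b')) + sA a1 + m'), ?_, ?_⟩
        · convert h' using 1
          simp [mul_assoc]
        · rw [hA.inv, abs_le]; omega

theorem KVal.exists (hA : IsSgn κA sA) (hB : IsSgn κB sB) (hi : ∀ c, iA (κA c) = iB (κB c))
    (hgen : ∀ p : G → Prop, p 1 → (∀ a g, p g → p (iA a * g)) →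
      (∀ b g, p g → p (iB b * g)) → ∀ g, p g) (g : G) :
    (∃ a, g = iA a) ∨ ∃ a k n, g = iA a * k ∧ KVal iA iB sA sB k n := by
  refine hgen (fun g => (∃ a, g = iA a) ∨ ∃ a k n, g = iA a * k ∧ KVal iA iB sA sB k n)
    (Or.inl ⟨1, by simp⟩) ?_ ?_ g
  · rintro a _ (⟨a', rfl⟩ | ⟨a', k, n, rfl, hk⟩)
    · exact Or.inl ⟨a * a', by simp⟩
    · exact Or.inr ⟨a * a', k, n, by simp [mul_assoc], hk⟩
  · rintro b g hg
    by_cases hb : sB b = 0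
    · obtain ⟨c, rfl⟩ := (hB.zero b).1 hb
      rw [← hi]
      rcases hg with (⟨a', rfl⟩ | ⟨a', k, n, rfl, hk⟩)
      · exact Or.inl ⟨κA c * a', by simp⟩
      · exact Or.inr ⟨κA c * a', k, n, by simp [mul_assoc], hk⟩
    rcases hg with (⟨a', rfl⟩ | ⟨a', k, n, rfl, hk⟩)
    · exact Or.inr ⟨1, _, _, by simp, KVal.last b a' hb⟩
    by_cases ha : sA a' = 0
    swap
    · exact Or.inr ⟨1, _, _, by simp, KVal.step b a' k n hb ha hk⟩
    obtain ⟨c, rfl⟩ := (hA.zero _).1 ha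
    rw [hi]
    cases hk with
    | last b' a1 hb' =>
      by_cases h0 : sB (b * κB c * b') = 0
      · obtain ⟨d, hd⟩ := (hB.zero _).1 h0
        left
        refine ⟨κA d * a1, ?_⟩
        rw [map_mul, hi, hd]
        simp [mul_assoc]
      · right
        exact ⟨1, _, _, by simp [mul_assoc], KVal.last _ a1 h0⟩
    | step b' a1 k' m' hb' ha1 hk' =>
      right
      by_cases h0 : sB (b * κB c * b') = 0
      · obtain ⟨d, hd⟩ := (hB.zero _).1 h0
        refine ⟨κA d * a1, k', m', ?_, hk'⟩
        rw [map_mul, hi, hd]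
        simp [mul_assoc]
      · exact ⟨1, _, _, by simp [mul_assoc], KVal.step _ a1 _ _ h0 ha1 hk'⟩

theorem core_leftRelConvex (hA : IsSgn κA sA) (hB : IsSgn κB sB)
    (hi : ∀ c, iA (κA c) = iB (κB c))
    (hgen : ∀ p : G → Prop, p 1 → (∀ a g, p g → p (iA a * g)) →
      (∀ b g, p g → p (iB b * g)) → ∀ g, p g)
    (hNF : ∀ g n, KVal iA iB sA sB g n → ∀ a, g ≠ iA a) :
    LeftRelConvex iA.range := by
  let P : G → Prop := fun g => ∃ a k n, g = iA a * k ∧ KVal iA iB sA sB k n ∧ 0 < n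
  have hP1 : ∀ a, ¬ P (iA a) := by
    rintro a ⟨a', k, n, h, hk, -⟩
    refine hNF k n hk (a'⁻¹ * a) ?_
    rw [map_mul, h]; simp
  have hPr : ∀ g a, P g → P (g * iA a) := by
    rintro _ a ⟨a', k, n, rfl, hk, hn⟩
    exact ⟨a', _, n, by rw [mul_assoc], hk.mul_right a, hn⟩
  have hPl : ∀ g a, P g → P (iA a * g) := by
    rintro _ a ⟨a', k, n, rfl, hk, hn⟩
    exact ⟨a * a', _, n, by simp [mul_assoc], hk, hn⟩
  have hPm : ∀ g h, P g → P h → P (g * h) := by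
    rintro _ _ ⟨a, k, n, rfl, hk, hn⟩ ⟨a1, k1, n1, rfl, hk1, hn1⟩
    obtain ⟨a2, h2⟩ := hk.inv hA hB
    rcases h2.main hA hB hi (a2 * a1) k1 n1 hk1 with ⟨h3, -⟩ | ⟨a', l, h3, h4⟩
    · omega
    · refine ⟨a * a'⁻¹, _, l, ?_, h3, ?_⟩
      · simp [mul_assoc]
      · rw [abs_le] at h4; omega
  have hPt : ∀ g, (∃ a, g = iA a) ∨ P g ∨ P g⁻¹ := by
    intro g
    rcases KVal.exists hA hB hi hgen g with h | ⟨a, k, n, rfl, hk⟩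
    · exact Or.inl h
    right
    rcases lt_trichotomy n 0 with h | h | h
    · right
      obtain ⟨a2, h2⟩ := hk.inv hA hB
      exact ⟨a2⁻¹, _, -n, by simp [mul_assoc], h2.mul_right a⁻¹, by omega⟩
    · have := hk.odd hA hB
      rw [h] at this
      exact absurd this (by decide)
    · exact Or.inl ⟨a, k, n, rfl, hk, h⟩
  let q : G → G ⧸ iA.range := fun a => (a : G ⧸ iA.range)
  have hq : ∀ a b, q a = q b ↔ ∃ c, iA c = a⁻¹ * b := fun a b => QuotientGroup.eq
  have hqs : ∀ x, ∃ g, q g = x := Quotient.mk_surjective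
  let r : G ⧸ iA.range → G ⧸ iA.range → Prop := fun x y =>
    x = y ∨ ∃ g h, q g = x ∧ q h = y ∧ P (g⁻¹ * h)
  have hr : ∀ g h, r (q g) (q h) ↔ q g = q h ∨ P (g⁻¹ * h) := by
    intro g h
    constructor
    · rintro (h1 | ⟨g', h', h1, h2, h3⟩)
      · exact Or.inl h1
      · right
        obtain ⟨c, hc⟩ := (hq _ _).1 h1.symm
        obtain ⟨d, hd⟩ := (hq _ _).1 h2
        have := hPl _ c (hPr _ d h3)
        rw [hc, hd] at this
        convert this using 1
        group
    · rintro (h1 | h1)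
      · exact Or.inl h1
      · exact Or.inr ⟨g, h, rfl, rfl, h1⟩
  have rrefl : ∀ x, r x x := fun x => Or.inl rfl
  have rtrans : ∀ x y z, r x y → r y z → r x z := by
    intro x y z
    obtain ⟨g, rfl⟩ := hqs x
    obtain ⟨h, rfl⟩ := hqs y
    obtain ⟨k, rfl⟩ := hqs z
    intro h1 h2
    rcases (hr _ _).1 h1 with e1 | e1
    · rwa [e1]
    rcases (hr _ _).1 h2 with e2 | e2
    · rwa [← e2]
    rw [hr]
    right
    convert hPm _ _ e1 e2 using 1
    group
  have ranti : ∀ x y, r x y → r y x → x = y := by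
    intro x y
    obtain ⟨g, rfl⟩ := hqs x
    obtain ⟨h, rfl⟩ := hqs y
    intro h1 h2
    rcases (hr _ _).1 h1 with e1 | e1
    · exact e1
    rcases (hr _ _).1 h2 with e2 | e2
    · exact e2.symm
    exfalso
    apply hP1 1
    convert hPm _ _ e1 e2 using 1
    simp
  have rtot : ∀ x y, r x y ∨ r y x := by
    intro x y
    obtain ⟨g, rfl⟩ := hqs x
    obtain ⟨h, rfl⟩ := hqs y
    rw [hr, hr]
    rcases hPt (g⁻¹ * h) with ⟨a, e⟩ | e | e
    · exact Or.inl (Or.inl ((hq _ _).2 ⟨a, e.symm⟩))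
    · exact Or.inl (Or.inr e)
    · right; right
      convert e using 1
      group
  refine ⟨r, { refl := rrefl, trans := rtrans, antisymm := ranti, total := rtot }, ?_⟩
  intro g x y
  obtain ⟨h, rfl⟩ := hqs x
  obtain ⟨k, rfl⟩ := hqs y
  intro h1
  change r (q (g * h)) (q (g * k))
  rw [hr] at h1 ⊢
  rcases h1 with h1 | h1
  · left
    exact congrArg (g • ·) h1
  · right
    convert h1 using 1
    group

end core

section normalForm

universe u v w

/-- The two factors as a `Bool`-indexed family in a common universe. -/
def Fam (A : Type u) (B : Type v) : Bool → Type (max u v)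
  | true => ULift.{v} A
  | false => ULift.{u} B

instance Fam.group (A : Type u) (B : Type v) [Group A] [Group B] : ∀ i, Group (Fam A B i)
  | true => inferInstanceAs (Group (ULift.{v} A))
  | false => inferInstanceAs (Group (ULift.{u} B))

/-- First factor. -/
def Fam.l (A : Type u) (B : Type v) [Group A] [Group B] : A →* Fam A B true :=
  (MulEquiv.ulift : ULift.{v} A ≃* A).symm.toMonoidHom

/-- Second factor. -/
def Fam.r (A : Type u) (B : Type v) [Group A] [Group B] : B →* Fam A B false :=
  (MulEquiv.ulift : ULift.{u} B ≃* B).symm.toMonoidHom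

theorem Fam.l_inj (A : Type u) (B : Type v) [Group A] [Group B] :
    Function.Injective (Fam.l A B) := (MulEquiv.ulift : ULift.{v} A ≃* A).symm.injective

theorem Fam.r_inj (A : Type u) (B : Type v) [Group A] [Group B] :
    Function.Injective (Fam.r A B) := (MulEquiv.ulift : ULift.{u} B ≃* B).symm.injective

/-- The two embeddings of the base group. -/
def Fam.phi {A : Type u} {B : Type v} {C : Type w} [Group A] [Group B] [Group C]
    (κA : C →* A) (κB : C →* B) : ∀ i, C →* Fam A B i
  | true => (Fam.l A B).comp κA
  | false => (Fam.r A B).comp κB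

theorem Fam.phi_inj {A : Type u} {B : Type v} {C : Type w} [Group A] [Group B] [Group C]
    (κA : C →* A) (κB : C →* B) (hA : Function.Injective κA) (hB : Function.Injective κB) :
    ∀ i, Function.Injective (Fam.phi κA κB i)
  | true => (Fam.l_inj A B).comp hA
  | false => (Fam.r_inj A B).comp hB

theorem KVal.nf {A : Type u} {B : Type v} {C : Type w} {G : Type*}
    [Group A] [Group B] [Group C] [Group G]
    {κA : C →* A} {κB : C →* B} {iA : A →* G} {iB : B →* G} {sA : A → ℤ} {sB : B → ℤ}
    (hjA : Function.Injective κA) (hjB : Function.Injective κB)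
    (hA : IsSgn κA sA) (hB : IsSgn κB sB)
    (π : G →* PushoutI (Fam.phi κA κB))
    (hπA : ∀ a, π (iA a) = PushoutI.of true (Fam.l A B a))
    (hπB : ∀ b, π (iB b) = PushoutI.of false (Fam.r A B b))
    (g : G) (n : ℤ) (h : KVal iA iB sA sB g n) (a : A) : g ≠ iA a := by
  obtain ⟨d⟩ := PushoutI.NormalWord.transversal_nonempty (Fam.phi κA κB)
    (Fam.phi_inj κA κB hjA hjB)
  have hrA : ∀ a, sA a ≠ 0 → Fam.l A B a ∉ (Fam.phi κA κB true).range := by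
    rintro a ha ⟨c, hc⟩
    exact ha ((hA.zero a).2 ⟨c, Fam.l_inj A B hc⟩)
  have hrB : ∀ b, sB b ≠ 0 → Fam.r A B b ∉ (Fam.phi κA κB false).range := by
    rintro b hb ⟨c, hc⟩
    exact hb ((hB.zero b).2 ⟨c, Fam.r_inj A B hc⟩)
  have hcons : ∀ (i : Bool) (x : Fam A B i) (w : PushoutI.NormalWord d), w.fstIdx ≠ some i →
      x ∉ (Fam.phi κA κB i).range →
      ∃ w' : PushoutI.NormalWord d, w'.prod = PushoutI.of i x * w.prod ∧ w'.fstIdx = some i := by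
    intro i x w h1 h2
    exact ⟨PushoutI.NormalWord.cons x w h1 h2, PushoutI.NormalWord.prod_cons x w h1 h2, by
      simp [CoprodI.Word.fstIdx, PushoutI.NormalWord.cons, CoprodI.Word.cons]⟩
  have hempty : ∀ i, (PushoutI.NormalWord.empty : PushoutI.NormalWord d).fstIdx ≠ some i := by
    intro i
    simp [CoprodI.Word.fstIdx, PushoutI.NormalWord.empty, CoprodI.Word.empty]
  have key1 : ∀ a, ∃ w : PushoutI.NormalWord d, w.prod = π (iA a) ∧ w.fstIdx ≠ some false := by
    intro a
    by_cases ha : sA a = 0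
    · obtain ⟨c, rfl⟩ := (hA.zero a).1 ha
      refine ⟨c • PushoutI.NormalWord.empty, ?_, hempty false⟩
      rw [PushoutI.NormalWord.prod_base_smul, PushoutI.NormalWord.prod_empty, mul_one, hπA,
        ← PushoutI.of_apply_eq_base _ true]
      rfl
    · obtain ⟨w, hw, hw'⟩ := hcons true (Fam.l A B a) PushoutI.NormalWord.empty (hempty true)
        (hrA a ha)
      refine ⟨w, ?_, ?_⟩
      · rw [hw, hπA, PushoutI.NormalWord.prod_empty, mul_one]
      · rw [hw']; simp
  have key2 : ∃ w : PushoutI.NormalWord d, w.prod = π g ∧ w.fstIdx = some false := by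
    clear a
    induction h with
    | last b a hb =>
      obtain ⟨w, hw, hw'⟩ := key1 a
      obtain ⟨w1, hw1, hw1'⟩ := hcons false (Fam.r A B b) w hw' (hrB b hb)
      refine ⟨w1, ?_, hw1'⟩
      rw [hw1, map_mul, hπB, hw]
    | step b a g n hb ha hg ih =>
      obtain ⟨w, hw, hw'⟩ := ih
      obtain ⟨w1, hw1, hw1'⟩ := hcons true (Fam.l A B a) w (by rw [hw']; simp) (hrA a ha)
      obtain ⟨w2, hw2, hw2'⟩ := hcons false (Fam.r A B b) w1 (by rw [hw1']; simp) (hrB b hb)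
      refine ⟨w2, ?_, hw2'⟩
      rw [hw2, hw1, map_mul, map_mul, hπB, hπA, hw]
  rintro rfl
  obtain ⟨w, hw, hw'⟩ := key1 a
  obtain ⟨w2, hw2, hw2'⟩ := key2
  have : w = w2 := PushoutI.NormalWord.prod_injective (hw.trans hw2.symm)
  subst this
  exact hw' hw2'

end normalForm

theorem amal_glue (κA : C →* A) (κB : C →* B) (c : C) :
    amalInl κA κB (κA c) = amalInr κA κB (κB c) := by
  refine QuotientGroup.eq.2 ?_
  exact Subgroup.subset_normalClosure ⟨c, rfl⟩

theorem amal_gen (κA : C →* A) (κB : C →* B) (p : Amal κA κB → Prop) (h1 : p 1)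
    (hl : ∀ a g, p g → p (amalInl κA κB a * g)) (hr : ∀ b g, p g → p (amalInr κA κB b * g))
    (g : Amal κA κB) : p g := by
  obtain ⟨x, rfl⟩ := QuotientGroup.mk'_surjective (amalRels κA κB) g
  induction x using Coprod.induction_on' with
  | one => exact h1
  | inl_mul a x ih => exact hl a _ ih
  | inr_mul b x ih => exact hr b _ ih

theorem amal_lift {H : Type*} [Group H] (κA : C →* A) (κB : C →* B) (f : A →* H) (g : B →* H)
    (hfg : ∀ c, f (κA c) = g (κB c)) :
    ∃ π : Amal κA κB →* H, (∀ a, π (amalInl κA κB a) = f a) ∧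
      ∀ b, π (amalInr κA κB b) = g b := by
  refine ⟨QuotientGroup.lift (amalRels κA κB) (Coprod.lift f g) ?_, ?_, ?_⟩
  · have : amalRels κA κB ≤ (Coprod.lift f g).ker := by
      refine Subgroup.normalClosure_le_normal ?_
      rintro _ ⟨c, rfl⟩
      simp [MonoidHom.mem_ker, hfg]
    exact this
  · intro a
    exact Coprod.lift_apply_inl f g a
  · intro b
    exact Coprod.lift_apply_inr f g b

/-- **Corollary.** If `κ_A(C)` is left relatively convex in `A` and `κ_B(C)` is left
relatively convex in `B`, then the images of `A` and `B` in `A ★_C B` are left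
relatively convex subgroups of `A ★_C B`. -/
theorem amalgam_factors_leftRelConvex (κA : C →* A) (κB : C →* B)
    (hA : Function.Injective κA) (hB : Function.Injective κB)
    (hcA : LeftRelConvex κA.range) (hcB : LeftRelConvex κB.range) :
    LeftRelConvex (amalInl κA κB).range ∧ LeftRelConvex (amalInr κA κB).range := by
  obtain ⟨sA, sgA⟩ := exists_isSgn κA hcA
  obtain ⟨sB, sgB⟩ := exists_isSgn κB hcB
  constructor
  · obtain ⟨π, h1, h2⟩ := amal_lift κA κB
      ((PushoutI.of (φ := Fam.phi κA κB) true).comp (Fam.l A B))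
      ((PushoutI.of (φ := Fam.phi κA κB) false).comp (Fam.r A B))
      (fun c => (PushoutI.of_apply_eq_base (Fam.phi κA κB) true c).trans
        (PushoutI.of_apply_eq_base (Fam.phi κA κB) false c).symm)
    exact core_leftRelConvex sgA sgB (amal_glue κA κB) (amal_gen κA κB)
      (fun g n h a => KVal.nf hA hB sgA sgB π h1 h2 g n h a)
  · obtain ⟨π, h1, h2⟩ := amal_lift κA κB
      ((PushoutI.of (φ := Fam.phi κB κA) false).comp (Fam.r B A))
      ((PushoutI.of (φ := Fam.phi κB κA) true).comp (Fam.l B A))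
      (fun c => (PushoutI.of_apply_eq_base (Fam.phi κB κA) false c).trans
        (PushoutI.of_apply_eq_base (Fam.phi κB κA) true c).symm)
    exact core_leftRelConvex sgB sgA (fun c => (amal_glue κA κB c).symm)
      (fun p h h' h'' => amal_gen κA κB p h h'' h')
      (fun g n h a => KVal.nf hB hA sgB sgA π h2 h1 g n h a)
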